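/- Let k ≥ 1 and let f : 𝔽₂^k × 𝔽₂^k → 𝔽₂ be a Boolean function in 2k variables. For x, u ∈ 𝔽₂^k define B(x,u) = ∑_{y ∈ 𝔽₂^k} (−1)^{f(x,y) ⊕ ⟨y,u⟩} ∈ ℤ (the bent square of f). Then f is bent if and only if for every u ∈ 𝔽₂^k there exists a Boolean function g_u : 𝔽₂^k → 𝔽₂ such that B(x,u) = W_{g_u}(x) for all x ∈ 𝔽₂^k, i.e., the transpose of every column of the bent square is the Walsh spectrum of some Boolean function in k variables. -/

import Mathlib

/-- `𝔽₂ⁿ`, the space of binary vectors of length `n`. -/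
abbrev BV (n : ℕ) : Type := Fin n → ZMod 2

/-- The inner product `⟨x, y⟩ = ⊕ᵢ xᵢ yᵢ` on `𝔽₂ⁿ`. -/
def ip {n : ℕ} (x y : BV n) : ZMod 2 := ∑ i, x i * y i

/-- The Walsh transform `W_f(y) = ∑_{x} (−1)^{f(x) ⊕ ⟨x,y⟩}` of a Boolean function. -/
def walsh {n : ℕ} (f : BV n → ZMod 2) (y : BV n) : ℤ :=
  ∑ x : BV n, (-1 : ℤ) ^ ((f x + ip x y).val)

/-- A Boolean function in `n` variables (`n` even) is bent if `|W_f(y)| = 2^{n/2}`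
for all `y`. -/
def IsBent (n : ℕ) (f : BV n → ZMod 2) : Prop :=
  ∀ y : BV n, |walsh f y| = 2 ^ (n / 2)

/-- `b_n`, the number of bent functions in `n` variables. -/
noncomputable def bentCount (n : ℕ) : ℕ :=
  Nat.card {f : BV n → ZMod 2 // IsBent n f}

/-- The Walsh transform of a Boolean function in `2k` variables, viewed as a
function on `𝔽₂^k × 𝔽₂^k`. -/
def walsh2 {k : ℕ} (f : BV k × BV k → ZMod 2) (u v : BV k) : ℤ :=
  ∑ x : BV k, ∑ y : BV k, (-1 : ℤ) ^ ((f (x, y) + ip x u + ip y v).val)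

/-- A Boolean function in `2k` variables is bent if `|W_f(u,v)| = 2^k` for all
`(u,v)`. -/
def IsBent2 (k : ℕ) (f : BV k × BV k → ZMod 2) : Prop :=
  ∀ u v : BV k, |walsh2 f u v| = 2 ^ k

/-- The bent square of `f`: `B(x,u) = ∑_y (−1)^{f(x,y) ⊕ ⟨y,u⟩}`. -/
def bentSq {k : ℕ} (f : BV k × BV k → ZMod 2) (x u : BV k) : ℤ :=
  ∑ y : BV k, (-1 : ℤ) ^ ((f (x, y) + ip y u).val)

theorem neg_one_pow_val_add (a b : ZMod 2) :
    (-1 : ℤ) ^ (a + b).val = (-1) ^ a.val * (-1) ^ b.val := by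
  revert a b; decide

theorem ip_comm {n : ℕ} (x y : BV n) : ip x y = ip y x :=
  Finset.sum_congr rfl fun _ _ => mul_comm _ _

theorem ip_add_left {n : ℕ} (x y z : BV n) : ip (x + y) z = ip x z + ip y z := by
  simp [ip, add_mul, Finset.sum_add_distrib]

theorem ip_add_right {n : ℕ} (x y z : BV n) : ip x (y + z) = ip x y + ip x z := by
  simp [ip, mul_add, Finset.sum_add_distrib]

/-- A nontrivial character of `𝔽₂ⁿ` sums to zero. -/
theorem sum_neg_one_pow_ip_eq_zero {n : ℕ} {w : BV n} (hw : w ≠ 0) :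
    ∑ x : BV n, (-1 : ℤ) ^ (ip x w).val = 0 := by
  obtain ⟨i, hi⟩ := Function.ne_iff.mp hw
  have hwi : w i = 1 := (by decide : ∀ a : ZMod 2, a ≠ 0 → a = 1) _ hi
  have he : ip (Pi.single i 1) w = 1 := by simp [ip, Pi.single_apply, hwi]
  have h := Equiv.sum_comp (Equiv.addRight (Pi.single i 1 : BV n))
    fun x => (-1 : ℤ) ^ (ip x w).val
  simp only [Equiv.coe_addRight, ip_add_left, he, neg_one_pow_val_add, ZMod.val_one, pow_one,
    mul_neg, mul_one, Finset.sum_neg_distrib] at h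
  linarith

/-- Orthogonality of the characters of `𝔽₂ⁿ`. -/
theorem sum_neg_one_pow_ip_mul {n : ℕ} (u v : BV n) :
    ∑ x : BV n, (-1 : ℤ) ^ (ip x u).val * (-1) ^ (ip x v).val = if u = v then 2 ^ n else 0 := by
  simp only [← neg_one_pow_val_add, ← ip_add_right]
  split_ifs with h
  · subst h
    simp [ip, CharTwo.add_self_eq_zero]
  · refine sum_neg_one_pow_ip_eq_zero fun h0 => h (funext fun i => ?_)
    exact CharTwo.add_eq_zero.mp (congrFun h0 i)

/-- The Walsh–Hadamard transform is its own inverse up to the factor `2ⁿ`. -/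
theorem walshHadamard_inversion {n : ℕ} (F : BV n → ℤ) (x : BV n) :
    ∑ u : BV n, (-1 : ℤ) ^ (ip u x).val * ∑ y : BV n, (-1 : ℤ) ^ (ip y u).val * F y =
      2 ^ n * F x := by
  simp only [Finset.mul_sum, ← mul_assoc]
  rw [Finset.sum_comm]
  simp only [← Finset.sum_mul]
  calc ∑ y : BV n, (∑ u : BV n, (-1 : ℤ) ^ (ip u x).val * (-1) ^ (ip y u).val) * F y
      = ∑ y : BV n, (if x = y then 2 ^ n else 0) * F y := by
        refine Finset.sum_congr rfl fun y _ => ?_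
        rw [← sum_neg_one_pow_ip_mul x y]
        simp only [ip_comm y]
    _ = 2 ^ n * F x := by simp

theorem walsh_eq_sum_mul {n : ℕ} (g : BV n → ZMod 2) (y : BV n) :
    walsh g y = ∑ x : BV n, (-1 : ℤ) ^ (ip x y).val * (-1) ^ (g x).val := by
  simp only [walsh, neg_one_pow_val_add, mul_comm]

theorem walsh2_eq_sum_bentSq {k : ℕ} (f : BV k × BV k → ZMod 2) (u v : BV k) :
    walsh2 f u v = ∑ x : BV k, (-1 : ℤ) ^ (ip x u).val * bentSq f x v := by
  simp only [walsh2, bentSq, Finset.mul_sum, neg_one_pow_val_add]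
  exact Finset.sum_congr rfl fun _ _ => Finset.sum_congr rfl fun _ _ => by ring

/-- `f : 𝔽₂^k × 𝔽₂^k → 𝔽₂` (`k ≥ 1`) is bent if and only if the
transpose of every column of its bent square is the Walsh spectrum of some
Boolean function in `k` variables. -/
theorem stmt_13 (k : ℕ) (hk : 1 ≤ k) (f : BV k × BV k → ZMod 2) :
    IsBent2 k f ↔
      ∀ u : BV k, ∃ g : BV k → ZMod 2, ∀ x : BV k, bentSq f x u = walsh g x := by
  constructor
  · intro hf v
    have hs : ∀ u : BV k, ∃ a : ZMod 2, walsh2 f u v = 2 ^ k * (-1) ^ a.val := fun u => by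
      rcases (abs_eq (by positivity)).mp (hf u v) with h | h
      · exact ⟨0, by simp [h]⟩
      · exact ⟨1, by simp [h, ZMod.val_one]⟩
    choose g hg using hs
    refine ⟨g, fun x => ?_⟩
    have h := walshHadamard_inversion (fun y => bentSq f y v) x
    simp only [← walsh2_eq_sum_bentSq, hg, mul_left_comm _ ((2 : ℤ) ^ k)] at h
    rw [← Finset.mul_sum, ← walsh_eq_sum_mul] at h
    exact (mul_left_cancel₀ (by positivity) h).symm
  · intro h u v
    obtain ⟨g, hg⟩ := h v
    simp only [walsh2_eq_sum_bentSq, hg, walsh_eq_sum_mul]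
    rw [walshHadamard_inversion fun y => (-1 : ℤ) ^ (g y).val]
    simp [abs_mul]
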